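/- arXiv:1804.03169 — 3 statements merged into one kernel-verified Lean document; each statement's English description precedes it below -/
import Mathlib

section
/- Let α ∈ (0,1], b > 0, and let f : [0,b) → ℝ be differentiable on (0,b) and continuous at 0, with its classical derivative f' integrable on every interval (0,t) with t < b. Then for all t ∈ (0,b), I^α(D^α f)(t) = f(t) − f(0). -/
open Filter Set MeasureTheory

/-- `f` is α-differentiable at `t` with conformable fractional derivative `L`:
`D^α f(t) = lim_{ε→0} (f(t + ε t^{1-α}) - f t)/ε = L`. -/
def HasConfDerivAt (α : ℝ) (f : ℝ → ℝ) (L t : ℝ) : Prop :=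
  Filter.Tendsto (fun ε : ℝ => (f (t + ε * t ^ (1 - α)) - f t) / ε)
    (nhdsWithin 0 {(0 : ℝ)}ᶜ) (nhds L)

/-- The conformable fractional derivative operator `D^α` (junk value if the limit
does not exist). -/
noncomputable def confDeriv (α : ℝ) (f : ℝ → ℝ) (t : ℝ) : ℝ :=
  limUnder (nhdsWithin 0 {(0 : ℝ)}ᶜ)
    (fun ε : ℝ => (f (t + ε * t ^ (1 - α)) - f t) / ε)

/-- A differentiable function is conformably differentiable, with `D^α f(t) = t^{1-α} f'(t)`. -/
theorem HasDerivAt.hasConfDerivAt {α t f' : ℝ} {f : ℝ → ℝ} (hf : HasDerivAt f f' t) :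
    HasConfDerivAt α f (f' * t ^ (1 - α)) t := by
  have hline : HasDerivAt (fun ε : ℝ => t + ε * t ^ (1 - α)) (t ^ (1 - α)) 0 := by
    simpa using ((hasDerivAt_id (0 : ℝ)).mul_const (t ^ (1 - α))).const_add t
  have hcomp : HasDerivAt (fun ε : ℝ => f (t + ε * t ^ (1 - α))) (f' * t ^ (1 - α)) 0 :=
    HasDerivAt.comp (h₂ := f) 0 (by simpa using hf) hline
  simpa [HasConfDerivAt, div_eq_inv_mul] using hcomp.tendsto_slope_zero

theorem confDeriv_mul_rpow {α t : ℝ} {f : ℝ → ℝ} (ht : 0 < t) (hf : DifferentiableAt ℝ f t) :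
    confDeriv α f t * t ^ (α - 1) = deriv f t := by
  have h : confDeriv α f t = deriv f t * t ^ (1 - α) :=
    (hf.hasDerivAt.hasConfDerivAt (α := α)).limUnder_eq
  rw [h, mul_assoc, ← Real.rpow_add ht]
  simp

theorem conformable_integral_conformable_deriv (α b : ℝ) (hα : 0 < α ∧ α ≤ 1)
    (hb : 0 < b) (f : ℝ → ℝ)
    (hdiff : ∀ s ∈ Set.Ioo (0 : ℝ) b, DifferentiableAt ℝ f s)
    (hcont : ContinuousWithinAt f (Set.Ici 0) 0)
    (hint : ∀ t, t < b → MeasureTheory.IntegrableOn (deriv f) (Set.Ioo 0 t)) :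
    ∀ t ∈ Set.Ioo (0 : ℝ) b,
      (∫ τ in (0 : ℝ)..t, confDeriv α f τ * τ ^ (α - 1)) = f t - f 0 := by
  intro t ht
  have hcongr : (∫ τ in (0 : ℝ)..t, confDeriv α f τ * τ ^ (α - 1)) =
      ∫ τ in (0 : ℝ)..t, deriv f τ := by
    rw [intervalIntegral.integral_of_le ht.1.le, intervalIntegral.integral_of_le ht.1.le]
    exact setIntegral_congr_fun measurableSet_Ioc fun τ hτ =>
      confDeriv_mul_rpow hτ.1 (hdiff τ ⟨hτ.1, hτ.2.trans_lt ht.2⟩)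
  rw [hcongr]
  refine intervalIntegral.integral_eq_sub_of_hasDerivAt_of_le ht.1.le ?_
    (fun x hx => (hdiff x ⟨hx.1, hx.2.trans ht.2⟩).hasDerivAt)
    ((intervalIntegrable_iff_integrableOn_Ioo_of_le ht.1.le).2 (hint t ht.2))
  intro x hx
  rcases hx.1.eq_or_lt with rfl | h0
  · exact hcont.mono Icc_subset_Ici_self
  · exact (hdiff x ⟨h0, hx.2.trans_lt ht.2⟩).continuousAt.continuousWithinAt
end

section
/- Let 0 < α, β ≤ 1 and let Ψ : (0,∞) → ℝ be three times continuously differentiable. If Ψ satisfies the reduced equation D^{3α}Ψ(ζ) − 6·Ψ(ζ)²·D^αΨ(ζ) − (β/3)·(ζ^α/α)·D^αΨ(ζ) − (β/3)·Ψ(ζ) = 0 for all ζ > 0, then the function u(t,x) = t^{−β/3}·Ψ(x·t^{−β/(3α)}) satisfies the time–space conformable fractional modified KdV equation ∂^β u/∂t^β − 6u²·∂^α u/∂x^α + ∂^{3α} u/∂x^{3α} = 0 for all t, x > 0. -/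
open Filter Set MeasureTheory

theorem confDeriv_eq_of_hasDerivAt {α t f' : ℝ} {f : ℝ → ℝ}
    (hf : HasDerivAt f f' t) : confDeriv α f t = t ^ (1 - α) * f' := by
  have hline : HasDerivAt (fun ε : ℝ => t + ε * t ^ (1 - α)) (t ^ (1 - α)) 0 := by
    simpa using ((hasDerivAt_id (0 : ℝ)).mul_const (t ^ (1 - α))).const_add t
  have hf0 : HasDerivAt f f' (t + 0 * t ^ (1 - α)) := by simpa using hf
  have hcomp := (hf0.comp (0 : ℝ) hline).tendsto_slope_zero
  refine Filter.Tendsto.limUnder_eq ?_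
  rw [mul_comm]
  refine hcomp.congr fun ε => ?_
  simp [div_eq_inv_mul]

theorem contDiffOn_confDeriv {α : ℝ} {f : ℝ → ℝ} {m n : WithTop ℕ∞} (hmn : m + 1 ≤ n)
    (hf : ContDiffOn ℝ n f (Ioi 0)) : ContDiffOn ℝ m (confDeriv α f) (Ioi 0) := by
  have hn : n ≠ 0 := by
    rintro rfl
    simp at hmn
  have hrpow : ContDiffOn ℝ m (fun t : ℝ => t ^ (1 - α)) (Ioi 0) :=
    contDiffOn_id.rpow_const_of_ne fun t ht => ne_of_gt ht
  refine (hrpow.mul (hf.deriv_of_isOpen isOpen_Ioi hmn)).congr fun t ht => ?_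
  exact confDeriv_eq_of_hasDerivAt
    ((hf.differentiableOn hn).differentiableAt (Ioi_mem_nhds ht)).hasDerivAt

theorem confDeriv_eqOn_of_eqOn_const_mul_comp_mul {α k c : ℝ} {f g : ℝ → ℝ} (hc : 0 < c)
    (hf : DifferentiableOn ℝ f (Ioi 0)) (hg : EqOn g (fun x => k * f (x * c)) (Ioi 0)) :
    EqOn (confDeriv α g) (fun x => k * c ^ α * confDeriv α f (x * c)) (Ioi 0) := by
  intro x hx
  have hx0 : 0 < x := hx
  have hxc : 0 < x * c := mul_pos hx0 hc
  have hfd : HasDerivAt f (deriv f (x * c)) (x * c) :=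
    (hf.differentiableAt (Ioi_mem_nhds hxc)).hasDerivAt
  have hgd : HasDerivAt g (k * (deriv f (x * c) * c)) x :=
    ((hfd.comp x (hasDerivAt_mul_const c)).const_mul k).congr_of_eventuallyEq
      (hg.eventuallyEq_of_mem (Ioi_mem_nhds hx0))
  have hcα : c ^ α * c ^ (1 - α) = c := by
    rw [← Real.rpow_add hc]
    simp
  change confDeriv α g x = k * c ^ α * confDeriv α f (x * c)
  rw [confDeriv_eq_of_hasDerivAt hgd, confDeriv_eq_of_hasDerivAt hfd,
    Real.mul_rpow hx0.le hc.le]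
  linear_combination (-(k * x ^ (1 - α) * deriv f (x * c))) * hcα

theorem mkdv_similarity_reduction (α β : ℝ) (hα : 0 < α ∧ α ≤ 1) (hβ : 0 < β ∧ β ≤ 1)
    (Ψ : ℝ → ℝ) (hΨ : ContDiffOn ℝ 3 Ψ (Set.Ioi 0))
    (hred : ∀ ζ > (0 : ℝ),
      confDeriv α (confDeriv α (confDeriv α Ψ)) ζ
        - 6 * (Ψ ζ) ^ 2 * confDeriv α Ψ ζ
        - (β / 3) * (ζ ^ α / α) * confDeriv α Ψ ζ
        - (β / 3) * Ψ ζ = 0)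
    (u : ℝ → ℝ → ℝ)
    (hu : ∀ t x : ℝ, u t x = t ^ (-β / 3) * Ψ (x * t ^ (-β / (3 * α)))) :
    ∀ t > (0 : ℝ), ∀ x > (0 : ℝ),
      confDeriv β (fun s => u s x) t
        - 6 * (u t x) ^ 2 * confDeriv α (u t) x
        + confDeriv α (confDeriv α (confDeriv α (u t))) x = 0 := by
  obtain ⟨hα0, -⟩ := hα
  intro t ht x hx
  set c : ℝ := t ^ (-β / (3 * α)) with hc
  set k : ℝ := t ^ (-β / 3) with hk
  have hc0 : 0 < c := Real.rpow_pos_of_pos ht _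
  have hz : 0 < x * c := mul_pos hx hc0
  have hcα : c ^ α = k := by
    rw [hc, hk, ← Real.rpow_mul ht.le]
    congr 1
    field_simp
  have hk3 : k ^ 3 = t ^ (-β) := by
    rw [hk, ← Real.rpow_mul_natCast ht.le]
    congr 1
    push_cast
    ring
  have hΨ1 : ContDiffOn ℝ 2 (confDeriv α Ψ) (Ioi 0) :=
    contDiffOn_confDeriv (by norm_num) hΨ
  have hΨ2 : ContDiffOn ℝ 1 (confDeriv α (confDeriv α Ψ)) (Ioi 0) :=
    contDiffOn_confDeriv (by norm_num) hΨ1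
  have hu0 : EqOn (u t) (fun y => k * Ψ (y * c)) (Ioi 0) := fun y _ => hu t y
  have hu1 := confDeriv_eqOn_of_eqOn_const_mul_comp_mul (α := α) hc0
    (hΨ.differentiableOn (by norm_num)) hu0
  have hu2 := confDeriv_eqOn_of_eqOn_const_mul_comp_mul (α := α) hc0
    (hΨ1.differentiableOn (by norm_num)) hu1
  have hu3 := confDeriv_eqOn_of_eqOn_const_mul_comp_mul (α := α) hc0
    (hΨ2.differentiableOn (by norm_num)) hu2
  have hΨd : HasDerivAt Ψ (deriv Ψ (x * c)) (x * c) :=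
    ((hΨ.differentiableOn (by norm_num)).differentiableAt (Ioi_mem_nhds hz)).hasDerivAt
  have hD : (x * c) ^ α * confDeriv α Ψ (x * c) = x * c * deriv Ψ (x * c) := by
    rw [confDeriv_eq_of_hasDerivAt hΨd, ← mul_assoc, ← Real.rpow_add hz]
    simp
  have hpow (p : ℝ) : HasDerivAt (fun s : ℝ => s ^ p) (p * t ^ (p - 1)) t :=
    Real.hasDerivAt_rpow_const (Or.inl ht.ne')
  have hut : HasDerivAt (fun s => u s x)
      (-β / 3 * t ^ (-β / 3 - 1) * Ψ (x * c) +
        k * (deriv Ψ (x * c) * (x * (-β / (3 * α) * t ^ (-β / (3 * α) - 1))))) t := by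
    simp only [hu]
    exact (hpow _).mul (hΨd.comp t ((hpow _).const_mul x))
  have htime : confDeriv β (fun s => u s x) t =
      -(β / 3) * k ^ 4 * (Ψ (x * c) + (x * c) ^ α / α * confDeriv α Ψ (x * c)) := by
    have hβ1 : t ^ (1 - β) = k ^ 3 * t := by
      rw [hk3, sub_eq_add_neg, Real.rpow_add ht, Real.rpow_one, mul_comm]
    rw [confDeriv_eq_of_hasDerivAt hut, Real.rpow_sub_one ht.ne', Real.rpow_sub_one ht.ne',
      ← hc, ← hk, hβ1, div_mul_eq_mul_div ((x * c) ^ α), hD]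
    field_simp
    ring
  have h1 : confDeriv α (u t) x = k * c ^ α * confDeriv α Ψ (x * c) := hu1 hx
  have h3 : confDeriv α (confDeriv α (confDeriv α (u t))) x =
      k * c ^ α * c ^ α * c ^ α * confDeriv α (confDeriv α (confDeriv α Ψ)) (x * c) := hu3 hx
  have h0 : u t x = k * Ψ (x * c) := hu t x
  rw [htime, h1, h3, h0, hcα]
  linear_combination k ^ 4 * hred (x * c) hz
end

section
/- Let 0 < α, β ≤ 1, let a, b be real constants, and let Ψ : (0,∞) → ℝ be twice continuously differentiable. If Ψ satisfies the reduced equation b·D^{2α}Ψ(ζ) + a·Ψ(ζ)·D^αΨ(ζ) − (β/2)·(ζ^α/α)·D^αΨ(ζ) − (β/2)·Ψ(ζ) = 0 for all ζ > 0, then the function u(t,x) = t^{−β/2}·Ψ(x·t^{−β/(2α)}) satisfies the time–space conformable fractional Burgers equation ∂^β u/∂t^β + a·u·∂^α u/∂x^α + b·∂^{2α} u/∂x^{2α} = 0 for all t, x > 0. -/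
open Filter Set MeasureTheory

theorem HasDerivAt.confDeriv_eq {f : ℝ → ℝ} {f' t : ℝ} (h : HasDerivAt f f' t) (α : ℝ) :
    confDeriv α f t = t ^ (1 - α) * f' := by
  have hg : HasDerivAt (fun ε : ℝ => f (t + ε * t ^ (1 - α))) (f' * (1 * t ^ (1 - α))) 0 := by
    refine HasDerivAt.comp (h₂ := f) 0 ?_ (((hasDerivAt_id (0 : ℝ)).mul_const _).const_add t)
    simpa using h
  have hlim := hasDerivAt_iff_tendsto_slope_zero.1 hg
  refine Tendsto.limUnder_eq ?_
  convert hlim using 2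
  · simp [div_eq_inv_mul]
  · ring

theorem DifferentiableAt.confDeriv_const_mul_comp_mul {f : ℝ → ℝ} {x c : ℝ} (hx : 0 < x)
    (hc : 0 < c) (h : DifferentiableAt ℝ f (x * c)) (α A : ℝ) :
    confDeriv α (fun y => A * f (y * c)) x = A * c ^ α * confDeriv α f (x * c) := by
  have hd : HasDerivAt (fun y => A * f (y * c)) (A * (deriv f (x * c) * (1 * c))) x :=
    (HasDerivAt.comp (h₂ := f) x h.hasDerivAt ((hasDerivAt_id x).mul_const c)).const_mul A
  have hcc : c ^ α * c ^ (1 - α) = c := by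
    rw [← Real.rpow_add hc]; simp
  rw [hd.confDeriv_eq, h.hasDerivAt.confDeriv_eq, Real.mul_rpow hx.le hc.le]
  linear_combination -(A * x ^ (1 - α) * deriv f (x * c)) * hcc

theorem confDeriv_congr_of_eventuallyEq {f g : ℝ → ℝ} {t : ℝ} (h : f =ᶠ[nhds t] g)
    (hg : DifferentiableAt ℝ g t) (α : ℝ) : confDeriv α f t = confDeriv α g t := by
  rw [hg.hasDerivAt.confDeriv_eq, (hg.hasDerivAt.congr_of_eventuallyEq h).confDeriv_eq]

theorem ContDiffOn.differentiableAt_confDeriv {f : ℝ → ℝ} (hf : ContDiffOn ℝ 2 f (Set.Ioi 0))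
    (α : ℝ) {z : ℝ} (hz : 0 < z) : DifferentiableAt ℝ (confDeriv α f) z := by
  have hd : DifferentiableAt ℝ (deriv f) z :=
    (((contDiffOn_succ_iff_deriv_of_isOpen (n := 1) isOpen_Ioi).1
      (by simpa [one_add_one_eq_two] using hf)).2.2.differentiableOn (by simp)).differentiableAt
      (Ioi_mem_nhds hz)
  have hp : DifferentiableAt ℝ (fun y : ℝ => y ^ (1 - α)) z :=
    Real.differentiableAt_rpow_const_of_ne _ hz.ne'
  refine (hp.mul hd).congr_of_eventuallyEq ?_
  filter_upwards [Ioi_mem_nhds hz] with y hy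
  exact ((hf.differentiableOn (by simp)).differentiableAt
    (Ioi_mem_nhds hy)).hasDerivAt.confDeriv_eq α

theorem burgers_similarity_reduction (α β a b : ℝ) (hα : 0 < α ∧ α ≤ 1)
    (hβ : 0 < β ∧ β ≤ 1)
    (Ψ : ℝ → ℝ) (hΨ : ContDiffOn ℝ 2 Ψ (Set.Ioi 0))
    (hred : ∀ ζ > (0 : ℝ),
      b * confDeriv α (confDeriv α Ψ) ζ
        + a * Ψ ζ * confDeriv α Ψ ζ
        - (β / 2) * (ζ ^ α / α) * confDeriv α Ψ ζ
        - (β / 2) * Ψ ζ = 0)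
    (u : ℝ → ℝ → ℝ)
    (hu : ∀ t x : ℝ, u t x = t ^ (-β / 2) * Ψ (x * t ^ (-β / (2 * α)))) :
    ∀ t > (0 : ℝ), ∀ x > (0 : ℝ),
      confDeriv β (fun s => u s x) t
        + a * u t x * confDeriv α (u t) x
        + b * confDeriv α (confDeriv α (u t)) x = 0 := by
  intro t ht x hx
  have hΨd : ∀ z > (0 : ℝ), DifferentiableAt ℝ Ψ z := fun z hz =>
    (hΨ.differentiableOn (by simp)).differentiableAt (Ioi_mem_nhds hz)
  set c : ℝ := t ^ (-β / (2 * α)) with hc_def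
  set A : ℝ := t ^ (-β / 2) with hA_def
  have hc : 0 < c := Real.rpow_pos_of_pos ht _
  have hζ : 0 < x * c := mul_pos hx hc
  have hcA : c ^ α = A := by
    rw [hc_def, hA_def, ← Real.rpow_mul ht.le]
    congr 1
    have := hα.1.ne'
    field_simp
  have hut : u t = fun y => A * Ψ (y * c) := funext fun y => hu t y
  have hfirst : ∀ y > (0 : ℝ), confDeriv α (u t) y = A * A * confDeriv α Ψ (y * c) := by
    intro y hy
    rw [hut, (hΨd _ (mul_pos hy hc)).confDeriv_const_mul_comp_mul hy hc, hcA]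
  have hG := hΨ.differentiableAt_confDeriv α hζ
  have hsecond : confDeriv α (confDeriv α (u t)) x
      = A * A * A * confDeriv α (confDeriv α Ψ) (x * c) := by
    have heq : confDeriv α (u t) =ᶠ[nhds x] fun y => A * A * confDeriv α Ψ (y * c) := by
      filter_upwards [Ioi_mem_nhds hx] with y hy using hfirst y hy
    rw [confDeriv_congr_of_eventuallyEq heq, hG.confDeriv_const_mul_comp_mul hx hc, hcA]
    exact (DifferentiableAt.comp (g := confDeriv α Ψ) x hG
      (differentiableAt_id.mul_const c)).const_mul _
  have htime : confDeriv β (fun s => u s x) t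
      = -(A * A * A) * ((β / 2) * ((x * c) ^ α / α) * confDeriv α Ψ (x * c)
        + (β / 2) * Ψ (x * c)) := by
    have hd : HasDerivAt (fun s => u s x)
        (-β / 2 * t ^ (-β / 2 - 1) * Ψ (x * c)
          + A * (deriv Ψ (x * c) * (x * (-β / (2 * α) * t ^ (-β / (2 * α) - 1))))) t := by
      simp only [hu]
      exact (Real.hasDerivAt_rpow_const (Or.inl ht.ne')).mul
        (HasDerivAt.comp (h₂ := Ψ) t (hΨd _ hζ).hasDerivAt
          ((Real.hasDerivAt_rpow_const (Or.inl ht.ne')).const_mul x))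
    have hζα : (x * c) ^ α * (x * c) ^ (1 - α) = x * c := by
      rw [← Real.rpow_add hζ]; simp
    have hAA : t ^ (1 - β) = t * (A * A) := by
      rw [hA_def, ← Real.rpow_add ht, Real.rpow_sub ht, Real.rpow_one,
        show -β / 2 + -β / 2 = -β by ring, Real.rpow_neg ht.le, div_eq_mul_inv]
    rw [hd.confDeriv_eq, (hΨd _ hζ).hasDerivAt.confDeriv_eq, hAA, Real.rpow_sub_one ht.ne',
      Real.rpow_sub_one ht.ne', ← hA_def, ← hc_def]
    have hα0 := hα.1.ne'
    have ht0 := ht.ne'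
    field_simp
    linear_combination A ^ 3 * β * deriv Ψ (x * c) * hζα
  rw [htime, hfirst x hx, hsecond, hu t x]
  linear_combination A * A * A * hred (x * c) hζ
end
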